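/- Let R be an irreducible negative definite root lattice of rank at most 12, and let R ⊆ R' ⊆ R ⊗ ℚ be an even overlattice of finite index. Then the 2-adic valuation of the index [R' : R] is at most 1, and if it equals 1 then R is isometric to the A₇ root lattice or to the D₈ root lattice. -/

import Mathlib

open Matrix

/-- The Gram matrix of the `Aₙ` root lattice (a chain of `n` nodes). -/
def aGram (n : ℕ) : Matrix (Fin n) (Fin n) ℤ :=
  Matrix.of fun i j =>
    if i = j then -2 else if i.val + 1 = j.val ∨ j.val + 1 = i.val then 1 else 0

/-- The Gram matrix of the `Dₙ` root lattice: node `0` attached to node `2`, and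
nodes `1, 2, …, n-1` forming a chain. -/
def dGram (n : ℕ) : Matrix (Fin n) (Fin n) ℤ :=
  Matrix.of fun i j =>
    if i = j then -2
    else if (i.val = 0 ∧ j.val = 2) ∨ (j.val = 0 ∧ i.val = 2) then 1
    else if (1 ≤ i.val ∧ i.val + 1 = j.val) ∨ (1 ≤ j.val ∧ j.val + 1 = i.val) then 1
    else 0

/-- The ℤ-submodule `R` of the rational quadratic space `(V, B)` is isometric to the
root lattice with Gram matrix `G`. -/
def IsoToGramQ {V : Type*} [AddCommGroup V] [Module ℚ V]
    (B : V →ₗ[ℚ] V →ₗ[ℚ] ℚ) (R : Submodule ℤ V) (m : ℕ)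
    (G : Matrix (Fin m) (Fin m) ℤ) : Prop :=
  ∃ f : (Fin m → ℤ) →ₗ[ℤ] V, Function.Injective f ∧ LinearMap.range f = R ∧
    ∀ x y : Fin m → ℤ, B (f x) (f y) = ((x ⬝ᵥ G.mulVec y : ℤ) : ℚ)

section RootLattice

variable {L : Type*} [AddCommGroup L] {b : L →ₗ[ℤ] L →ₗ[ℤ] ℤ} {R : Submodule ℤ L} {x : L}

/-- `r` is a root of `R` for the positive form `b`. -/
def IsRootIn (b : L →ₗ[ℤ] L →ₗ[ℤ] ℤ) (R : Submodule ℤ L) (r : L) : Prop :=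
  r ∈ R ∧ b r r = 2

/-- `R` is an irreducible root lattice, of full rank in the positive definite lattice `(L, b)`.
Irreducibility is stated in terms of the span of a set of roots. -/
structure IsFullRootLattice (b : L →ₗ[ℤ] L →ₗ[ℤ] ℤ) (R : Submodule ℤ L) : Prop where
  symm : ∀ u v, b u v = b v u
  pos : ∀ u, u ≠ 0 → 0 < b u u
  gen : R ≤ Submodule.span ℤ {r | IsRootIn b R r}
  irr : ∀ A : Set L, A.Nonempty → (∀ a ∈ A, IsRootIn b R a) →
    (∀ r, IsRootIn b R r → r ∈ Submodule.span ℤ A ∨ ∀ a ∈ A, b r a = 0) →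
    R ≤ Submodule.span ℤ A
  torsion : ∀ u : L, ∃ n : ℤ, n ≠ 0 ∧ n • u ∈ R

/-- `x` pairs with the roots of `R` to `-1`, `0` or `1`, and represents an element of order two
modulo `R`. -/
structure IsMinusculeHalf (b : L →ₗ[ℤ] L →ₗ[ℤ] ℤ) (R : Submodule ℤ L) (x : L) : Prop where
  le_one : ∀ r, IsRootIn b R r → b x r ≤ 1
  double_mem : x + x ∈ R
  notMem : x ∉ R

/-- `r` is a root of `R` pairing to `1` with `x`. -/
def IsUpperRoot (b : L →ₗ[ℤ] L →ₗ[ℤ] ℤ) (R : Submodule ℤ L) (x r : L) : Prop :=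
  IsRootIn b R r ∧ b x r = 1

/-- A family of pairwise orthogonal upper roots. -/
def IsOrthoFamily (b : L →ₗ[ℤ] L →ₗ[ℤ] ℤ) (R : Submodule ℤ L) (x : L) {k : ℕ}
    (β : Fin k → L) : Prop :=
  (∀ i, IsUpperRoot b R x (β i)) ∧ ∀ i j, i ≠ j → b (β i) (β j) = 0

/-- A family of pairwise orthogonal upper roots with sum `x + x`. -/
def IsFrame (b : L →ₗ[ℤ] L →ₗ[ℤ] ℤ) (R : Submodule ℤ L) (x : L) {k : ℕ}
    (β : Fin k → L) : Prop :=
  IsOrthoFamily b R x β ∧ x + x = ∑ i, β i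

/-- `r` is an upper root joining the members `i` and `j` of the family `β`. -/
def IsEdge (b : L →ₗ[ℤ] L →ₗ[ℤ] ℤ) (R : Submodule ℤ L) (x : L) {k : ℕ}
    (β : Fin k → L) (i j : Fin k) (r : L) : Prop :=
  IsUpperRoot b R x r ∧ b r (β i) = 1 ∧ b r (β j) = 1

theorem IsRootIn.neg {r : L} (hr : IsRootIn b R r) : IsRootIn b R (-r) :=
  ⟨R.neg_mem hr.1, by simpa using hr.2⟩

namespace IsFullRootLattice

variable (h : IsFullRootLattice b R)
include h

theorem nonneg (u : L) : 0 ≤ b u u := by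
  by_cases hu : u = 0
  · simp [hu]
  · exact (h.pos u hu).le

theorem eq_zero_of_self {u : L} (hu : b u u = 0) : u = 0 := by
  by_contra hne
  exact (h.pos u hne).ne' hu

theorem eq_of_double {u v : L} (huv : u + u = v + v) : u = v := by
  have h0 : (u - v) + (u - v) = 0 := by
    rw [sub_add_sub_comm, huv, sub_self]
  have h1 : b ((u - v) + (u - v)) (u - v) = 0 := by rw [h0]; simp
  rw [map_add, LinearMap.add_apply] at h1
  exact sub_eq_zero.1 (h.eq_zero_of_self (by linarith))

theorem root_le_two {r s : L} (hr : IsRootIn b R r) (hs : IsRootIn b R s) : b r s ≤ 2 := by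
  have h1 := h.nonneg (r - s)
  simp only [map_sub, LinearMap.sub_apply] at h1
  linarith [hr.2, hs.2, h.symm r s]

theorem root_eq_of_two {r s : L} (hr : IsRootIn b R r) (hs : IsRootIn b R s)
    (hrs : b r s = 2) : r = s := by
  refine sub_eq_zero.1 (h.eq_zero_of_self ?_)
  simp only [map_sub, LinearMap.sub_apply]
  linarith [hr.2, hs.2, h.symm r s]

theorem root_sub {r s : L} (hr : IsRootIn b R r) (hs : IsRootIn b R s)
    (hrs : b r s = 1) : IsRootIn b R (r - s) := by
  refine ⟨R.sub_mem hr.1 hs.1, ?_⟩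
  simp only [map_sub, LinearMap.sub_apply]
  linarith [hr.2, hs.2, h.symm r s]

theorem root_neg_two_le {r s : L} (hr : IsRootIn b R r) (hs : IsRootIn b R s) : -2 ≤ b r s := by
  have h1 := h.root_le_two hr.neg hs
  simp only [map_neg, LinearMap.neg_apply] at h1
  linarith

theorem root_add {r s : L} (hr : IsRootIn b R r) (hs : IsRootIn b R s)
    (hrs : b r s = -1) : IsRootIn b R (r + s) := by
  have := h.root_sub hr hs.neg (by simp [hrs])
  rwa [sub_neg_eq_add] at this

theorem add_eq_zero_of_neg_two {r s : L} (hr : IsRootIn b R r) (hs : IsRootIn b R s)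
    (hrs : b r s = -2) : r + s = 0 := by
  have := h.root_eq_of_two hr hs.neg (by simp [hrs])
  rw [this, neg_add_cancel]

theorem exists_multiset_of_mem {y : L} (hy : y ∈ R) :
    ∃ s : Multiset L, (∀ r ∈ s, IsRootIn b R r) ∧ s.sum = y := by
  have hy' : y ∈ AddSubgroup.closure {r | IsRootIn b R r} := by
    rw [← Submodule.span_int_eq_addSubgroupClosure]
    exact h.gen hy
  clear hy
  induction hy' using AddSubgroup.closure_induction with
  | mem u hu => exact ⟨{u}, by simpa using hu, by simp⟩
  | zero => exact ⟨0, by simp, by simp⟩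
  | add u v _ _ hu hv =>
    obtain ⟨s, hs, rfl⟩ := hu
    obtain ⟨t, ht, rfl⟩ := hv
    refine ⟨s + t, fun r hr => ?_, Multiset.sum_add s t⟩
    exact (Multiset.mem_add.1 hr).elim (hs r) (ht r)
  | neg u _ hu =>
    obtain ⟨s, hs, rfl⟩ := hu
    refine ⟨s.map fun r => -r, fun r hr => ?_, Multiset.sum_map_neg' s⟩
    obtain ⟨u, hu, rfl⟩ := Multiset.mem_map.1 hr
    exact (hs u hu).neg

/-- A vector of `R` pairing to at most `1` with every root vanishes. -/
theorem eq_zero_of_le_one {y : L} (hy : y ∈ R) (hle : ∀ r, IsRootIn b R r → b y r ≤ 1) :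
    y = 0 := by
  classical
  obtain ⟨s, hs, hmin⟩ := exists_minimalFor_of_wellFoundedLT
    (fun s : Multiset L => (∀ r ∈ s, IsRootIn b R r) ∧ s.sum = y) Multiset.card
    (h.exists_multiset_of_mem hy)
  obtain ⟨hroot, hsum⟩ := hs
  induction s using Multiset.induction with
  | empty => simpa using hsum.symm
  | cons r t _ =>
    exfalso
    have hr : IsRootIn b R r := hroot r (Multiset.mem_cons_self r t)
    have hnn : ∀ u ∈ t, 0 ≤ b u r := by
      intro u hu
      by_contra! hneg
      obtain ⟨t', rfl⟩ := Multiset.exists_cons_of_mem hu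
      have hur : IsRootIn b R u := hroot u (by simp)
      have ht' : ∀ w ∈ t', IsRootIn b R w := fun w hw => hroot w (by simp [hw])
      have h2 := h.root_neg_two_le hur hr
      obtain h3 | h3 : b u r = -2 ∨ b u r = -1 := by omega
      · have hz := h.add_eq_zero_of_neg_two hur hr h3
        have := hmin (j := t') ⟨ht', by
          rw [← hsum, Multiset.sum_cons, Multiset.sum_cons, ← add_assoc, add_comm r u, hz,
            zero_add]⟩ (by simp; omega)
        simp at this
      · have hz := h.root_add hur hr h3
        have := hmin (j := (u + r) ::ₘ t') ⟨by
            intro w hw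
            rcases Multiset.mem_cons.1 hw with rfl | hw
            · exact hz
            · exact ht' w hw, by
          rw [← hsum, Multiset.sum_cons, Multiset.sum_cons, Multiset.sum_cons, ← add_assoc,
            add_comm r u]⟩ (by simp)
        simp at this
    have h1 : b t.sum r = (t.map fun u => b u r).sum :=
      map_multiset_sum (b.flip r) t
    have h2 : 0 ≤ (t.map fun u => b u r).sum := by
      refine Multiset.sum_nonneg fun c hc => ?_
      obtain ⟨u, hu, rfl⟩ := Multiset.mem_map.1 hc
      exact hnn u hu
    have h3 := hle r hr
    rw [← hsum, Multiset.sum_cons, map_add, LinearMap.add_apply, hr.2] at h3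
    linarith

end IsFullRootLattice

section Frame

variable {k : ℕ} {β : Fin k → L}

theorem IsMinusculeHalf.neg_one_le (hx : IsMinusculeHalf b R x) {r : L} (hr : IsRootIn b R r) :
    -1 ≤ b x r := by
  have := hx.le_one _ hr.neg
  simp only [map_neg] at this
  linarith

theorem IsUpperRoot.nonneg (h : IsFullRootLattice b R) (hx : IsMinusculeHalf b R x)
    {r s : L} (hr : IsUpperRoot b R x r) (hs : IsUpperRoot b R x s) : 0 ≤ b r s := by
  by_contra! hneg
  have h2 := h.root_neg_two_le hr.1 hs.1
  obtain h3 | h3 : b r s = -2 ∨ b r s = -1 := by omega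
  · have := congrArg (b x) (h.add_eq_zero_of_neg_two hr.1 hs.1 h3)
    simp [hr.2, hs.2] at this
  · have := hx.le_one _ (h.root_add hr.1 hs.1 h3)
    simp [hr.2, hs.2] at this

theorem IsUpperRoot.le_one (h : IsFullRootLattice b R) {r s : L} (hr : IsUpperRoot b R x r)
    (hs : IsUpperRoot b R x s) (hne : r ≠ s) : b r s ≤ 1 := by
  have h2 := h.root_le_two hr.1 hs.1
  have h3 : b r s ≠ 2 := fun h3 => hne (h.root_eq_of_two hr.1 hs.1 h3)
  omega

/-- A sum of integers at most `1` is at most the number of indices where the value is `1`. -/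
theorem sum_le_card_filter_one (f : Fin k → ℤ) (hf : ∀ i, f i ≤ 1) :
    ∑ i, f i ≤ (Finset.univ.filter fun i => f i = 1).card := by
  rw [Finset.card_filter]
  push_cast
  refine Finset.sum_le_sum fun i _ => ?_
  have := hf i
  split_ifs <;> omega

/-- A maximal family of orthogonal upper roots is a frame. -/
theorem IsOrthoFamily.isFrame (h : IsFullRootLattice b R) (hx : IsMinusculeHalf b R x)
    (hβ : IsOrthoFamily b R x β)
    (hmax : ∀ r, IsUpperRoot b R x r → ∃ i, b r (β i) ≠ 0) : IsFrame b R x β := by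
  refine ⟨hβ, sub_eq_zero.1 (h.eq_zero_of_le_one (R.sub_mem hx.double_mem
    (R.sum_mem fun i _ => (hβ.1 i).1.1)) fun r hr => ?_)⟩
  have key : b (x + x - ∑ i, β i) r = 2 * b x r - ∑ i, b r (β i) := by
    rw [map_sub, LinearMap.sub_apply, map_add, LinearMap.add_apply, h.symm (∑ i, β i), map_sum]
    ring
  rw [key]
  have hneg := hx.neg_one_le hr
  have hpos := hx.le_one r hr
  obtain h1 | h1 | h1 : b x r = 1 ∨ b x r = 0 ∨ b x r = -1 := by omega
  · have hup : IsUpperRoot b R x r := ⟨hr, h1⟩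
    obtain ⟨i, hi⟩ := hmax r hup
    have hnn : ∀ j, 0 ≤ b r (β j) := fun j => hup.nonneg h hx (hβ.1 j)
    have : b r (β i) ≤ ∑ j, b r (β j) :=
      Finset.single_le_sum (f := fun j => b r (β j)) (fun j _ => hnn j) (Finset.mem_univ i)
    have := hnn i
    omega
  · have hle : ∀ i, b (-r) (β i) ≤ 1 := by
      intro i
      have h2 := h.root_le_two hr.neg (hβ.1 i).1
      have h3 : b (-r) (β i) ≠ 2 := fun h3 => by
        have := congrArg (b x) (h.root_eq_of_two hr.neg (hβ.1 i).1 h3)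
        simp [h1, (hβ.1 i).2] at this
      omega
    have hsum := sum_le_card_filter_one _ hle
    have hcard : (Finset.univ.filter fun i => b (-r) (β i) = 1).card ≤ 1 := by
      by_contra! hc
      obtain ⟨i, j, hi, hj, hij⟩ := Finset.one_lt_card_iff.1 hc
      have hi := (Finset.mem_filter.1 hi).2
      have hj := (Finset.mem_filter.1 hj).2
      have h5 := h.root_sub (h.root_sub hr.neg (hβ.1 i).1 hi) (hβ.1 j).1 (by
        rw [map_sub, LinearMap.sub_apply, hj, hβ.2 i j hij, sub_zero])
      have := hx.neg_one_le h5
      simp [h1, (hβ.1 i).2, (hβ.1 j).2] at this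
    simp only [map_neg, LinearMap.neg_apply, Finset.sum_neg_distrib] at hsum hcard
    omega
  · have hup : IsUpperRoot b R x (-r) := ⟨hr.neg, by simp [h1]⟩
    by_cases hex : ∃ i, -r = β i
    · obtain ⟨i, hi⟩ := hex
      obtain rfl : r = -β i := by rw [← hi, neg_neg]
      have : ∑ j, b (-β i) (β j) = -2 := by
        rw [Finset.sum_eq_single i]
        · simp [(hβ.1 i).1.2]
        · intro j _ hj
          simp [hβ.2 i j hj.symm]
        · simp
      omega
    push Not at hex
    have hsum := sum_le_card_filter_one _ fun i => hup.le_one h (hβ.1 i) (hex i)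
    have hcard : (Finset.univ.filter fun i => b (-r) (β i) = 1).card ≤ 2 := by
      by_contra! hc
      obtain ⟨i, j, l, hi, hj, hl, hij, hil, hjl⟩ := Finset.two_lt_card_iff.1 hc
      have hi := (Finset.mem_filter.1 hi).2
      have hj := (Finset.mem_filter.1 hj).2
      have hl := (Finset.mem_filter.1 hl).2
      have h5 := h.root_sub (h.root_sub hr.neg (hβ.1 i).1 hi) (hβ.1 j).1 (by
        rw [map_sub, LinearMap.sub_apply, hj, hβ.2 i j hij, sub_zero])
      have h6 := h.root_sub h5 (hβ.1 l).1 (by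
        simp only [map_sub, LinearMap.sub_apply, hl, hβ.2 i l hil, hβ.2 j l hjl, sub_zero])
      have := hx.neg_one_le h6
      simp only [map_sub, hup.2, (hβ.1 i).2, (hβ.1 j).2, (hβ.1 l).2] at this
      omega
    simp only [map_neg, LinearMap.neg_apply, Finset.sum_neg_distrib] at hsum hcard
    omega

/-- If the size of linearly independent families in `R` is bounded, a frame exists. -/
theorem exists_isFrame (h : IsFullRootLattice b R) (hx : IsMinusculeHalf b R x) {N : ℕ}
    (hrank : ∀ (n : ℕ) (v : Fin n → L), (∀ i, v i ∈ R) → LinearIndependent ℤ v → n ≤ N) :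
    ∃ (k : ℕ) (β : Fin k → L), IsFrame b R x β := by
  by_contra! hno
  have hall : ∀ k : ℕ, ∃ β : Fin k → L, IsOrthoFamily b R x β := by
    intro k
    induction k with
    | zero => exact ⟨Fin.elim0, fun i => i.elim0, fun i => i.elim0⟩
    | succ k ih =>
      obtain ⟨β, hβ⟩ := ih
      have : ¬ ∀ r, IsUpperRoot b R x r → ∃ i, b r (β i) ≠ 0 :=
        fun hmax => hno k β (hβ.isFrame h hx hmax)
      push Not at this
      obtain ⟨r, hr, hr0⟩ := this
      refine ⟨Fin.cons r β, fun i => ?_, fun i j => ?_⟩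
      · refine Fin.cases ?_ (fun i => ?_) i
        · simpa using hr
        · simpa using hβ.1 i
      · refine Fin.cases ?_ (fun i => ?_) i <;> refine Fin.cases ?_ (fun j => ?_) j
        · simp
        · simpa using fun _ => hr0 j
        · simpa [h.symm (β i) r] using hr0 i
        · simpa using hβ.2 i j
  obtain ⟨β, hβ⟩ := hall (N + 1)
  have := hrank (N + 1) β (fun i => (hβ.1 i).1.1) (by
    rw [Fintype.linearIndependent_iff]
    intro g hg i
    have h1 : b (∑ j, g j • β j) (β i) = 0 := by rw [hg]; simp
    rw [map_sum, LinearMap.sum_apply, Finset.sum_eq_single i] at h1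
    · simpa [(hβ.1 i).1.2] using h1
    · intro j _ hj
      simp [hβ.2 j i hj]
    · simp)
  omega

namespace IsFrame

variable (h : IsFullRootLattice b R) (hx : IsMinusculeHalf b R x) (hβ : IsFrame b R x β)
include h hx hβ

theorem nonneg {r : L} (hr : IsUpperRoot b R x r) (i : Fin k) : 0 ≤ b r (β i) :=
  hr.nonneg h hx (hβ.1.1 i)

omit hx in
theorem sum_eq_two {r : L} (hr : IsUpperRoot b R x r) : ∑ i, b r (β i) = 2 := by
  have h1 : b r (x + x) = 2 := by rw [map_add, h.symm r x, hr.2]; rfl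
  rwa [hβ.2, map_sum] at h1

theorem eq_zero_of_edge {i j l : Fin k} {r : L} (hr : IsEdge b R x β i j r) (hij : i ≠ j)
    (hil : i ≠ l) (hjl : j ≠ l) : b r (β l) = 0 := by
  have h1 := Finset.sum_le_sum_of_subset_of_nonneg (f := fun m => b r (β m))
    (Finset.subset_univ ({i, j, l} : Finset (Fin k))) fun m _ _ => hβ.nonneg h hx hr.1 m
  rw [hβ.sum_eq_two h hr.1, Finset.sum_insert (by simp [hij, hil]),
    Finset.sum_insert (by simp [hjl]), Finset.sum_singleton, hr.2.1, hr.2.2] at h1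
  have := hβ.nonneg h hx hr.1 l
  omega

theorem edge_of_ne_zero {i j : Fin k} {r : L} (hr : IsUpperRoot b R x r) (hij : i ≠ j)
    (hi : b r (β i) ≠ 0) (hj : b r (β j) ≠ 0) : IsEdge b R x β i j r := by
  have h1 := Finset.sum_le_sum_of_subset_of_nonneg (f := fun m => b r (β m))
    (Finset.subset_univ ({i, j} : Finset (Fin k))) fun m _ _ => hβ.nonneg h hx hr m
  rw [hβ.sum_eq_two h hr, Finset.sum_insert (by simp [hij]), Finset.sum_singleton] at h1
  have := hβ.nonneg h hx hr i
  have := hβ.nonneg h hx hr j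
  exact ⟨hr, by omega, by omega⟩

/-- An upper root is a member of the frame or joins two members. -/
theorem eq_or_edge {r : L} (hr : IsUpperRoot b R x r) :
    ∃ i, r = β i ∨ ∃ j, i ≠ j ∧ IsEdge b R x β i j r := by
  have h2 := hβ.sum_eq_two h hr
  obtain ⟨i, -, hi⟩ : ∃ i ∈ Finset.univ, b r (β i) ≠ 0 :=
    Finset.exists_ne_zero_of_sum_ne_zero (by rw [h2]; norm_num)
  refine ⟨i, ?_⟩
  by_cases hri : r = β i
  · exact .inl hri
  right
  have h3 := hr.le_one h (hβ.1.1 i) hri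
  have h4 : ∑ j ∈ Finset.univ.erase i, b r (β j) ≠ 0 := by
    have := Finset.add_sum_erase Finset.univ (fun j => b r (β j)) (Finset.mem_univ i)
    omega
  obtain ⟨j, hj, hj0⟩ := Finset.exists_ne_zero_of_sum_ne_zero h4
  have hij : i ≠ j := (Finset.ne_of_mem_erase hj).symm
  exact ⟨j, hij, hβ.edge_of_ne_zero h hx hr hij hi hj0⟩

omit hx in
theorem flip {i j : Fin k} {r : L} (hij : i ≠ j) (hr : IsEdge b R x β i j r) :
    IsEdge b R x β i j (β i + β j - r) := by
  obtain ⟨⟨⟨hrR, hr2⟩, hrx⟩, hri, hrj⟩ := hr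
  have h1 := h.symm r (β i)
  have h2 := h.symm r (β j)
  have h3 := hβ.1.2 i j hij
  have h4 := hβ.1.2 j i hij.symm
  refine ⟨⟨⟨R.sub_mem (R.add_mem (hβ.1.1 i).1.1 (hβ.1.1 j).1.1) hrR, ?_⟩, ?_⟩, ?_, ?_⟩ <;>
  · simp only [map_add, map_sub, LinearMap.add_apply, LinearMap.sub_apply]
    linarith [(hβ.1.1 i).1.2, (hβ.1.1 j).1.2, (hβ.1.1 i).2, (hβ.1.1 j).2]

theorem eq_zero_of_disjoint {i j : Fin k} {r s : L} (hij : i ≠ j) (hr : IsUpperRoot b R x r)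
    (hs : IsEdge b R x β i j s) (hi : b r (β i) = 0) (hj : b r (β j) = 0) : b r s = 0 := by
  have h1 := hr.nonneg h hx hs.1
  have h2 := hr.nonneg h hx (hβ.flip h hij hs).1
  rw [map_sub, map_add, hi, hj] at h2
  omega

theorem edge_edge {i j l m : Fin k} {r s : L} (hij : i ≠ j) (hlm : l ≠ m) (hil : i ≠ l)
    (him : i ≠ m) (hjl : j ≠ l) (hjm : j ≠ m) (hr : IsEdge b R x β i j r)
    (hs : IsEdge b R x β l m s) : b r s = 0 :=
  hβ.eq_zero_of_disjoint h hx hlm hr.1 hs (hβ.eq_zero_of_edge h hx hr hij hil hjl)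
    (hβ.eq_zero_of_edge h hx hr hij him hjm)

omit h hx hβ in
theorem _root_.IsEdge.symm {i j : Fin k} {r : L} (hr : IsEdge b R x β i j r) :
    IsEdge b R x β j i r := ⟨hr.1, hr.2.2, hr.2.1⟩

/-- Adjacent edges are orthogonal, possibly after flipping the first one. -/
theorem orth_or_flip {i j l : Fin k} {r s : L} (hij : i ≠ j) (hil : i ≠ l) (hjl : j ≠ l)
    (hr : IsEdge b R x β i j r) (hs : IsEdge b R x β j l s) :
    b r s = 0 ∨ b (β i + β j - r) s = 0 := by
  have h1 := hr.1.nonneg h hx hs.1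
  have h2 := (hβ.flip h hij hr).1.nonneg h hx hs.1
  have h3 := hβ.eq_zero_of_edge h hx hs hjl hij.symm hil.symm
  rw [map_sub, LinearMap.sub_apply, map_add, LinearMap.add_apply, h.symm (β i), h.symm (β j),
    h3, hs.2.1] at h2 ⊢
  omega

theorem exists_edge_orth {i j l : Fin k} {s : L} (hij : i ≠ j) (hil : i ≠ l) (hjl : j ≠ l)
    (hne : ∃ r, IsEdge b R x β i j r) (hs : IsEdge b R x β j l s) :
    ∃ r, IsEdge b R x β i j r ∧ b r s = 0 := by
  obtain ⟨r, hr⟩ := hne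
  obtain h0 | h0 := hβ.orth_or_flip h hx hij hil hjl hr hs
  · exact ⟨r, hr, h0⟩
  · exact ⟨_, hβ.flip h hij hr, h0⟩

/-- Orthogonal adjacent edges compose. -/
theorem edge_comp {i j l : Fin k} {r s : L} (hij : i ≠ j) (hil : i ≠ l) (hjl : j ≠ l)
    (hr : IsEdge b R x β i j r) (hs : IsEdge b R x β j l s) (h0 : b r s = 0) :
    IsEdge b R x β i l (r + s - β j) := by
  have h1 := hβ.eq_zero_of_edge h hx hr hij hil hjl
  have h2 := hβ.eq_zero_of_edge h hx hs hjl hij.symm hil.symm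
  have h3 := hβ.1.2 j i hij.symm
  have h4 := hβ.1.2 j l hjl
  have hj := hβ.1.1 j
  have h5 := h.symm r s
  have h6 := h.symm r (β j)
  have h7 := h.symm s (β j)
  obtain ⟨⟨⟨hrR, hr2⟩, hrx⟩, hri, hrj⟩ := hr
  obtain ⟨⟨⟨hsR, hs2⟩, hsx⟩, hsj, hsl⟩ := hs
  refine ⟨⟨⟨R.sub_mem (R.add_mem hrR hsR) hj.1.1, ?_⟩, ?_⟩, ?_, ?_⟩ <;>
  · simp only [map_add, map_sub, LinearMap.add_apply, LinearMap.sub_apply]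
    linarith [hj.1.2, hj.2]

theorem exists_edge_comp_mem {N : Submodule ℤ L} (hN : ∀ i, β i ∈ N) {i j l : Fin k}
    (hij : i ≠ j) (hil : i ≠ l) (hjl : j ≠ l) (hr : ∃ r ∈ N, IsEdge b R x β i j r)
    (hs : ∃ s ∈ N, IsEdge b R x β j l s) : ∃ t ∈ N, IsEdge b R x β i l t := by
  obtain ⟨r, hrN, hr⟩ := hr
  obtain ⟨s, hsN, hs⟩ := hs
  obtain h0 | h0 := hβ.orth_or_flip h hx hij hil hjl hr hs
  · exact ⟨_, N.sub_mem (N.add_mem hrN hsN) (hN j), hβ.edge_comp h hx hij hil hjl hr hs h0⟩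
  · exact ⟨_, N.sub_mem (N.add_mem (N.sub_mem (N.add_mem (hN i) (hN j)) hrN) hsN) (hN j),
      hβ.edge_comp h hx hij hil hjl (hβ.flip h hij hr) hs h0⟩

theorem edges_mem_of_edges_mem {N : Submodule ℤ L} (hN : ∀ i, β i ∈ N) {i j l : Fin k}
    (hij : i ≠ j) (hil : i ≠ l) (hjl : j ≠ l) (hr : ∃ r ∈ N, IsEdge b R x β i j r)
    (hil' : ∀ t, IsEdge b R x β i l t → t ∈ N) (s : L) (hs : IsEdge b R x β j l s) : s ∈ N := by
  obtain ⟨r, hrN, hr⟩ := hr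
  have hcomp : ∀ r ∈ N, r + s - β j ∈ N → s ∈ N := fun r hrN hm => by
    have := N.sub_mem (N.add_mem hm (hN j)) hrN
    rwa [sub_add_cancel, add_sub_cancel_left] at this
  obtain h0 | h0 := hβ.orth_or_flip h hx hij hil hjl hr hs
  · exact hcomp r hrN (hil' _ (hβ.edge_comp h hx hij hil hjl hr hs h0))
  · exact hcomp _ (N.sub_mem (N.add_mem (hN i) (hN j)) hrN)
      (hil' _ (hβ.edge_comp h hx hij hil hjl (hβ.flip h hij hr) hs h0))

/-- Any two members of a frame are joined, and the upper roots span. -/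
theorem connected (i₀ : Fin k) :
    (∀ j, i₀ ≠ j → ∃ r, IsEdge b R x β i₀ j r) ∧
      R ≤ Submodule.span ℤ {r | IsUpperRoot b R x r} := by
  set C : Set (Fin k) := {j | i₀ = j ∨ ∃ r, IsEdge b R x β i₀ j r}
  set A : Set L := {w | IsUpperRoot b R x w ∧ ∃ i ∈ C, b w (β i) ≠ 0}
  have hsupp : ∀ w ∈ A, ∀ j, b w (β j) ≠ 0 → j ∈ C := by
    rintro w ⟨hw, i, hiC, hi⟩ j hj
    by_cases hij : i = j
    · exact hij ▸ hiC
    have hed := hβ.edge_of_ne_zero h hx hw hij hi hj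
    by_cases h0j : i₀ = j
    · exact .inl h0j
    rcases hiC with rfl | hi0
    · exact .inr ⟨w, hed⟩
    by_cases h0i : i₀ = i
    · exact .inr ⟨w, h0i ▸ hed⟩
    obtain ⟨r, hr⟩ := hi0
    obtain ⟨t, -, ht⟩ := hβ.exists_edge_comp_mem h hx (N := ⊤) (fun _ => trivial) h0i h0j hij
      ⟨r, trivial, hr⟩ ⟨w, trivial, hed⟩
    exact .inr ⟨t, ht⟩
  have horth : ∀ w, IsUpperRoot b R x w → w ∉ A → ∀ a ∈ A, b w a = 0 := by
    intro w hw hwA a ha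
    have hwC : ∀ i ∈ C, b w (β i) = 0 := by
      intro i hi
      by_contra hne
      exact hwA ⟨hw, i, hi, hne⟩
    obtain ⟨i, rfl | ⟨j, hij, hed⟩⟩ := hβ.eq_or_edge h hx ha.1
    · exact hwC i (hsupp _ ha i (by simp [(hβ.1.1 i).1.2]))
    · exact hβ.eq_zero_of_disjoint h hx hij hw hed
        (hwC i (hsupp a ha i (by simp [hed.2.1]))) (hwC j (hsupp a ha j (by simp [hed.2.2])))
  have hspan : ∀ w, IsUpperRoot b R x w → w ∈ Submodule.span ℤ A ∨ ∀ a ∈ A, b w a = 0 := by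
    intro w hw
    by_cases hwA : w ∈ A
    · exact .inl (Submodule.subset_span hwA)
    · exact .inr (horth w hw hwA)
  have hone : ∀ r, IsRootIn b R r → b x r = 0 → ∀ a ∈ A, b r a = 1 →
      r ∈ Submodule.span ℤ A := by
    intro r hr hr0 a ha hra
    have h1 : IsUpperRoot b R x (a - r) :=
      ⟨h.root_sub ha.1.1 hr (by rw [h.symm, hra]), by rw [map_sub, ha.1.2, hr0]; rfl⟩
    have h2 : a - r ∈ A := by
      by_contra hn
      have := horth _ h1 hn a ha
      rw [map_sub, LinearMap.sub_apply, ha.1.1.2, hra] at this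
      omega
    have := Submodule.sub_mem _ (Submodule.subset_span (R := ℤ) ha) (Submodule.subset_span h2)
    rwa [sub_sub_cancel] at this
  have hirr := h.irr A ⟨β i₀, hβ.1.1 i₀, i₀, .inl rfl, by simp [(hβ.1.1 i₀).1.2]⟩
    (fun a ha => ha.1.1) (by
      intro r hr
      have h1 := hx.neg_one_le hr
      have h2 := hx.le_one r hr
      obtain h3 | h3 | h3 : b x r = 1 ∨ b x r = 0 ∨ b x r = -1 := by omega
      · exact hspan r ⟨hr, h3⟩
      · by_contra! hcon
        obtain ⟨hns, a, ha, hra⟩ := hcon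
        have h4 := h.root_le_two hr ha.1.1
        have h5 := h.root_neg_two_le hr ha.1.1
        obtain h6 | h6 | h6 | h6 : b r a = 2 ∨ b r a = 1 ∨ b r a = -1 ∨ b r a = -2 := by omega
        · rw [h.root_eq_of_two hr ha.1.1 h6] at hns
          exact hns (Submodule.subset_span ha)
        · exact hns (hone r hr h3 a ha h6)
        · exact hns (neg_mem_iff.1 (hone (-r) hr.neg (by simp [h3]) a ha (by simp [h6])))
        · rw [eq_neg_of_add_eq_zero_left (h.add_eq_zero_of_neg_two hr ha.1.1 h6)] at hns
          exact hns (neg_mem (Submodule.subset_span ha))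
      · refine (hspan (-r) ⟨hr.neg, by simp [h3]⟩).imp neg_mem_iff.1 fun h4 a ha => ?_
        simpa using h4 a ha)
  refine ⟨fun j hj => ?_, hirr.trans (Submodule.span_mono fun a ha => ha.1)⟩
  by_contra hne
  have hjC : j ∉ C := fun hjC => hjC.elim hj hne
  have h1 : Submodule.span ℤ A ≤ LinearMap.ker (b (β j)) := by
    refine Submodule.span_le.2 fun a ha => ?_
    by_contra h2
    exact hjC (hsupp a ha j (by rw [h.symm]; exact h2))
  have h2 := h1 (hirr (hβ.1.1 j).1.1)
  rw [LinearMap.mem_ker, (hβ.1.1 j).1.2] at h2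
  omega

omit h hx in
theorem apply (i j : Fin k) : b (β i) (β j) = if i = j then 2 else 0 := by
  split_ifs with hij
  · rw [hij, (hβ.1.1 j).1.2]
  · exact hβ.1.2 i j hij

theorem edge_apply {i j : Fin k} (hij : i ≠ j) {r : L} (hr : IsEdge b R x β i j r) (l : Fin k) :
    b r (β l) = if l = i ∨ l = j then 1 else 0 := by
  split_ifs with hl
  · rcases hl with rfl | rfl
    · exact hr.2.1
    · exact hr.2.2
  · push Not at hl
    exact hβ.eq_zero_of_edge h hx hr hij hl.1.symm hl.2.symm

theorem exists_edge {i j : Fin k} (hij : i ≠ j) : ∃ r, IsEdge b R x β i j r :=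
  (hβ.connected h hx i).1 j hij

omit h hx in
theorem two_mul_self : 2 * b x x = k := by
  have h1 : b (x + x) (x + x) = 2 * k := by
    have h2 : ∀ i, b (x + x) (β i) = 2 := fun i => by
      rw [map_add, LinearMap.add_apply, (hβ.1.1 i).2]; rfl
    conv_lhs => enter [2]; rw [hβ.2]
    rw [map_sum, Finset.sum_congr rfl fun i _ => h2 i]
    simp [mul_comm]
  simp only [map_add, LinearMap.add_apply] at h1
  omega

theorem size_pos : 0 < k := by
  rcases Nat.eq_zero_or_pos k with rfl | hk
  · exfalso
    have h1 := hβ.2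
    rw [Finset.univ_eq_empty, Finset.sum_empty, ← add_zero (0 : L)] at h1
    exact hx.notMem (h.eq_of_double h1 ▸ R.zero_mem)
  · exact hk

end IsFrame
end Frame

/-- Eight orthogonal roots with a partial chain of joining roots are independent. -/
theorem linearIndependent_of_eight (hsymm : ∀ u v, b u v = b v u) {β : Fin 8 → L}
    {p q₀ q₁ q₂ q₃ : L}
    (hβ : ∀ i j, b (β i) (β j) = if i = j then 2 else 0)
    (hp : ∀ l, b p (β l) = if l = 1 ∨ l = 2 then 1 else 0)
    (h₀ : ∀ l, b q₀ (β l) = if l = 0 ∨ l = 1 then 1 else 0)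
    (h₁ : ∀ l, b q₁ (β l) = if l = 3 ∨ l = 2 then 1 else 0)
    (h₂ : ∀ l, b q₂ (β l) = if l = 4 ∨ l = 5 then 1 else 0)
    (h₃ : ∀ l, b q₃ (β l) = if l = 6 ∨ l = 7 then 1 else 0)
    (hpp : b p p = 2) (h₀₀ : b q₀ q₀ = 2) (h₁₁ : b q₁ q₁ = 2) (h₂₂ : b q₂ q₂ = 2)
    (h₃₃ : b q₃ q₃ = 2) (h₀p : b q₀ p = 0) (h₁p : b q₁ p = 0) (h₂p : b q₂ p = 0)
    (h₃p : b q₃ p = 0) (h₀₁ : b q₀ q₁ = 0) (h₀₂ : b q₀ q₂ = 0) (h₀₃ : b q₀ q₃ = 0)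
    (h₁₂ : b q₁ q₂ = 0) (h₁₃ : b q₁ q₃ = 0) (h₂₃ : b q₂ q₃ = 0) :
    LinearIndependent ℤ ![β 0, β 1, β 2, β 3, β 4, β 5, β 6, β 7, p, q₀, q₁, q₂, q₃] := by
  rw [Fintype.linearIndependent_iff]
  intro g hg
  simp only [Fin.sum_univ_succ, Finset.univ_eq_empty, Finset.sum_empty, Fin.isValue,
    Matrix.cons_val_zero, Matrix.cons_val_succ, add_zero] at hg
  have k0 := fun l => congrArg (b.flip (β l)) hg
  have kp := congrArg (b.flip p) hg
  have kq0 := congrArg (b.flip q₀) hg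
  have kq1 := congrArg (b.flip q₁) hg
  have kq2 := congrArg (b.flip q₂) hg
  have kq3 := congrArg (b.flip q₃) hg
  simp only [map_add, map_smul, LinearMap.flip_apply, map_zero, hβ, hp, h₀, h₁, h₂, h₃, hpp, h₀₀,
    h₁₁, h₂₂, h₃₃, h₀p, h₁p, h₂p, h₃p, h₀₁, h₀₂, h₀₃, h₁₂, h₁₃, h₂₃, smul_eq_mul,
    hsymm (β _) p, hsymm (β _) q₀, hsymm (β _) q₁, hsymm (β _) q₂, hsymm (β _) q₃,
    hsymm p q₀, hsymm p q₁, hsymm p q₂, hsymm p q₃, hsymm q₁ q₀, hsymm q₂ q₀, hsymm q₃ q₀,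
    hsymm q₂ q₁, hsymm q₃ q₁, hsymm q₃ q₂] at k0 kp kq0 kq1 kq2 kq3
  have a0 := k0 0
  have a1 := k0 1
  have a2 := k0 2
  have a3 := k0 3
  have a4 := k0 4
  have a5 := k0 5
  have a6 := k0 6
  have a7 := k0 7
  simp only [Fin.isValue, Fin.reduceEq, or_self, or_false, or_true, mul_zero, mul_one,
    add_zero, zero_add, ↓reduceIte] at a0 a1 a2 a3 a4 a5 a6 a7 kp kq0 kq1 kq2 kq3
  simp only [Fin.forall_fin_succ, IsEmpty.forall_iff, and_true]
  omega

/-- A frame in a lattice of rank at most `12` has four members. -/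
theorem IsFrame.size_eq_four (h : IsFullRootLattice b R) (hx : IsMinusculeHalf b R x) {k : ℕ}
    {β : Fin k → L} (hβ : IsFrame b R x β) (heven : Even (b x x))
    (hrank : ∀ (n : ℕ) (v : Fin n → L), (∀ i, v i ∈ R) → LinearIndependent ℤ v → n ≤ 12) :
    k = 4 := by
  obtain ⟨e, he⟩ := heven
  have h1 := hβ.two_mul_self
  have h2 := hβ.size_pos h hx
  by_contra hk
  have h8 : 8 ≤ k := by omega
  have hc : ∀ i j : Fin 8, Fin.castLE h8 i = Fin.castLE h8 j ↔ i = j :=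
    fun i j => (Fin.castLE_injective h8).eq_iff
  have hex : ∀ i j : Fin 8, i ≠ j →
      ∃ r, IsEdge b R x β (Fin.castLE h8 i) (Fin.castLE h8 j) r :=
    fun i j hij => hβ.exists_edge h hx ((hc i j).not.2 hij)
  have hne : ∀ i j : Fin 8, i ≠ j → Fin.castLE h8 i ≠ Fin.castLE h8 j :=
    fun i j => (hc i j).not.2
  have happ : ∀ i j : Fin 8, i ≠ j → ∀ r,
      IsEdge b R x β (Fin.castLE h8 i) (Fin.castLE h8 j) r → ∀ l,
      b r (β (Fin.castLE h8 l)) = if l = i ∨ l = j then 1 else 0 := by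
    intro i j hij r hr l
    simp only [hβ.edge_apply h hx (hne i j hij) hr, hc]
  obtain ⟨p, hp⟩ := hex 1 2 (by decide)
  obtain ⟨q₀, hq₀, h₀p⟩ := hβ.exists_edge_orth h hx (hne 0 1 (by decide)) (hne 0 2 (by decide))
    (hne 1 2 (by decide)) (hex 0 1 (by decide)) hp
  obtain ⟨q₁, hq₁, h₁p⟩ := hβ.exists_edge_orth h hx (hne 3 2 (by decide)) (hne 3 1 (by decide))
    (hne 2 1 (by decide)) (hex 3 2 (by decide)) hp.symm
  obtain ⟨q₂, hq₂⟩ := hex 4 5 (by decide)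
  obtain ⟨q₃, hq₃⟩ := hex 6 7 (by decide)
  have hdisj : ∀ i j l m : Fin 8, i ≠ j → l ≠ m → i ≠ l → i ≠ m → j ≠ l → j ≠ m → ∀ r s,
      IsEdge b R x β (Fin.castLE h8 i) (Fin.castLE h8 j) r →
      IsEdge b R x β (Fin.castLE h8 l) (Fin.castLE h8 m) s → b r s = 0 :=
    fun i j l m h1 h2 h3 h4 h5 h6 r s hr hs => hβ.edge_edge h hx (hne _ _ h1) (hne _ _ h2)
      (hne _ _ h3) (hne _ _ h4) (hne _ _ h5) (hne _ _ h6) hr hs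
  have hli := linearIndependent_of_eight (β := fun i => β (Fin.castLE h8 i)) h.symm
    (fun i j => by simp only [hβ.apply, hc])
    (happ 1 2 (by decide) p hp) (happ 0 1 (by decide) q₀ hq₀) (happ 3 2 (by decide) q₁ hq₁)
    (happ 4 5 (by decide) q₂ hq₂) (happ 6 7 (by decide) q₃ hq₃)
    hp.1.1.2 hq₀.1.1.2 hq₁.1.1.2 hq₂.1.1.2 hq₃.1.1.2 h₀p h₁p
    (hdisj 4 5 1 2 (by decide) (by decide) (by decide) (by decide) (by decide) (by decide)
      _ _ hq₂ hp)
    (hdisj 6 7 1 2 (by decide) (by decide) (by decide) (by decide) (by decide) (by decide)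
      _ _ hq₃ hp)
    (hdisj 0 1 3 2 (by decide) (by decide) (by decide) (by decide) (by decide) (by decide)
      _ _ hq₀ hq₁)
    (hdisj 0 1 4 5 (by decide) (by decide) (by decide) (by decide) (by decide) (by decide)
      _ _ hq₀ hq₂)
    (hdisj 0 1 6 7 (by decide) (by decide) (by decide) (by decide) (by decide) (by decide)
      _ _ hq₀ hq₃)
    (hdisj 3 2 4 5 (by decide) (by decide) (by decide) (by decide) (by decide) (by decide)
      _ _ hq₁ hq₂)
    (hdisj 3 2 6 7 (by decide) (by decide) (by decide) (by decide) (by decide) (by decide)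
      _ _ hq₁ hq₃)
    (hdisj 4 5 6 7 (by decide) (by decide) (by decide) (by decide) (by decide) (by decide)
      _ _ hq₂ hq₃)
  have := hrank 13 _ (fun i => by
    fin_cases i <;>
    first
    | exact (hβ.1.1 _).1.1
    | exact hp.1.1.1
    | exact hq₀.1.1.1
    | exact hq₁.1.1.1
    | exact hq₂.1.1.1
    | exact hq₃.1.1.1) hli
  omega

section Classification

variable {β : Fin 4 → L} {p q w : L}
  (h : IsFullRootLattice b R) (hx : IsMinusculeHalf b R x) (hβ : IsFrame b R x β)
  (hq : IsEdge b R x β 0 1 q) (hp : IsEdge b R x β 1 2 p) (hw : IsEdge b R x β 2 3 w)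
include h hx hβ hq hp hw

theorem IsFrame.le_of_edges_mem {N : Submodule ℤ L} (hN : ∀ i, β i ∈ N) (hqN : q ∈ N)
    (hpN : p ∈ N) (hwN : w ∈ N) (h01 : ∀ t, IsEdge b R x β 0 1 t → t ∈ N) : R ≤ N := by
  have e01 : ∃ t ∈ N, IsEdge b R x β 0 1 t := ⟨q, hqN, hq⟩
  have e12 : ∃ t ∈ N, IsEdge b R x β 1 2 t := ⟨p, hpN, hp⟩
  have e23 : ∃ t ∈ N, IsEdge b R x β 2 3 t := ⟨w, hwN, hw⟩
  have e02 := hβ.exists_edge_comp_mem h hx hN (by decide) (by decide) (by decide) e01 e12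
  have e13 := hβ.exists_edge_comp_mem h hx hN (by decide) (by decide) (by decide) e12 e23
  have e03 := hβ.exists_edge_comp_mem h hx hN (by decide) (by decide) (by decide) e01 e13
  have hsymm : ∀ {i j}, (∃ t ∈ N, IsEdge b R x β i j t) → ∃ t ∈ N, IsEdge b R x β j i t :=
    fun ⟨t, htN, ht⟩ => ⟨t, htN, ht.symm⟩
  have hall : ∀ i j, i ≠ j → ∃ t ∈ N, IsEdge b R x β i j t := by
    intro i j hij
    fin_cases i <;> fin_cases j <;>
    first
    | exact absurd rfl hij
    | assumption
    | exact hsymm ‹_›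
  have hstep : ∀ a c m : Fin 4, a ≠ c → a ≠ m → m ≠ c →
      (∀ t, IsEdge b R x β a c t → t ∈ N) → ∀ t, IsEdge b R x β m c t → t ∈ N :=
    fun a c m hac ham hmc hall' t ht => hβ.edges_mem_of_edges_mem h hx hN ham hac hmc
      (hall a m ham) hall' t ht
  have hedge : ∀ i j, i ≠ j → ∀ t, IsEdge b R x β i j t → t ∈ N := by
    have h0 : ∀ j, j ≠ 0 → ∀ t, IsEdge b R x β j 0 t → t ∈ N := by
      intro j hj
      by_cases hj1 : j = 1
      · subst hj1
        exact fun t ht => h01 t ht.symm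
      · exact hstep 1 0 j (by decide) (Ne.symm hj1) hj fun t ht => h01 t ht.symm
    intro i j hij
    by_cases hj : j = 0
    · subst hj
      exact h0 i hij
    by_cases hi : i = 0
    · subst hi
      exact fun t ht => h0 j hj t ht.symm
    · exact hstep 0 j i (Ne.symm hj) (Ne.symm hi) hij fun t ht => h0 j hj t ht.symm
  refine (hβ.connected h hx 0).2.trans (Submodule.span_le.2 fun r hr => ?_)
  obtain ⟨i, rfl | ⟨j, hij, hed⟩⟩ := hβ.eq_or_edge h hx hr
  · exact hN i
  · exact hedge i j hij r hed

omit hp hw in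
/-- An edge parallel to `q` is `q`, its flip, or pairs to `1` with `q`. -/
theorem IsFrame.edge_trichotomy {t : L} (ht : IsEdge b R x β 0 1 t) :
    t = q ∨ t = β 0 + β 1 - q ∨ b t q = 1 := by
  have hf := hβ.flip h (by decide) hq
  have h1 := ht.1.nonneg h hx hq.1
  have h2 := h.root_le_two ht.1.1 hq.1.1
  obtain h3 | h3 | h3 : b t q = 2 ∨ b t q = 0 ∨ b t q = 1 := by omega
  · exact .inl (h.root_eq_of_two ht.1.1 hq.1.1 h3)
  · refine .inr (.inl (h.root_eq_of_two ht.1.1 hf.1.1 ?_))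
    rw [map_sub, map_add, ht.2.1, ht.2.2, h3]
    rfl
  · exact .inr (.inr h3)

/-- There are no three parallel edges pairing to `1` with each other. -/
theorem IsFrame.no_third_edge {s t : L} (hs : IsEdge b R x β 0 1 s) (ht : IsEdge b R x β 0 1 t)
    (hqp : b q p = 0) (hwp : b w p = 0) (hsp : b s p = 0) (htp : b t p = 0)
    (hsq : b s q = 1) (htq : b t q = 1) (hts : b t s = 1) : False := by
  have hqβ := hβ.edge_apply h hx (by decide) hq
  have hsβ := hβ.edge_apply h hx (by decide) hs
  have htβ := hβ.edge_apply h hx (by decide) ht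
  have hpβ := hβ.edge_apply h hx (by decide) hp
  have hwβ := hβ.edge_apply h hx (by decide) hw
  have hqw := hβ.edge_edge h hx (by decide) (by decide) (by decide) (by decide) (by decide)
    (by decide) hq hw
  have hsw := hβ.edge_edge h hx (by decide) (by decide) (by decide) (by decide) (by decide)
    (by decide) hs hw
  have htw := hβ.edge_edge h hx (by decide) (by decide) (by decide) (by decide) (by decide)
    (by decide) ht hw
  have hac := hβ.edge_comp h hx (by decide) (by decide) (by decide) hs hp hsp
  have hz : IsUpperRoot b R x (q + s + (p + p) + w - β 0 - (β 1 + β 1) - β 2) := by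
    refine ⟨⟨?_, ?_⟩, ?_⟩
    · have := fun i => (hβ.1.1 i).1.1
      exact R.sub_mem (R.sub_mem (R.sub_mem (R.add_mem (R.add_mem (R.add_mem hq.1.1.1 hs.1.1.1)
        (R.add_mem hp.1.1.1 hp.1.1.1)) hw.1.1.1) (this 0)) (R.add_mem (this 1) (this 1))) (this 2)
    · simp only [map_add, map_sub, LinearMap.add_apply, LinearMap.sub_apply, hβ.apply,
        h.symm (β _) q, h.symm (β _) s, h.symm (β _) p, h.symm (β _) w, hqβ, hsβ, hpβ, hwβ,
        hq.1.1.2, hs.1.1.2, hp.1.1.2, hw.1.1.2, hqp, h.symm p q, hwp, h.symm p w, hsp, h.symm p s,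
        hsq, h.symm q s, hqw, h.symm w q, hsw, h.symm w s]
      decide
    · simp only [map_add, map_sub, hq.1.2, hs.1.2, hp.1.2, hw.1.2, (hβ.1.1 _).2]
      norm_num
  have := ht.1.nonneg h hx hz
  simp only [map_add, map_sub, htβ, htp, htq, hts, htw] at this
  revert this
  decide

/-- A frame with four members is the frame of a lattice of type `A₇` or `D₈`. -/
theorem IsFrame.classification (hqp : b q p = 0) (hwp : b w p = 0) :
    (∃ v : Fin 7 → L, (∀ i j, b (v i) (v j) = -aGram 7 i j) ∧
      Submodule.span ℤ (Set.range v) = R ∧ x + x = v 0 + v 2 + v 4 + v 6) ∨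
    (∃ v : Fin 8 → L, (∀ i j, b (v i) (v j) = -dGram 8 i j) ∧
      Submodule.span ℤ (Set.range v) = R ∧ x + x = v 1 + v 3 + v 5 + v 7) := by
  have hqβ := hβ.edge_apply h hx (by decide) hq
  have hpβ := hβ.edge_apply h hx (by decide) hp
  have hwβ := hβ.edge_apply h hx (by decide) hw
  have hqw := hβ.edge_edge h hx (by decide) (by decide) (by decide) (by decide) (by decide)
    (by decide) hq hw
  have hxx : x + x = β 0 + β 1 + β 2 + β 3 := by rw [hβ.2, Fin.sum_univ_four]
  have hβR := fun i => (hβ.1.1 i).1.1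
  by_cases hs : ∃ s, IsEdge b R x β 0 1 s ∧ b s q = 1 ∧ b s p = 0
  · right
    obtain ⟨s, hs, hsq, hsp⟩ := hs
    have hsβ := hβ.edge_apply h hx (by decide) hs
    have hsw := hβ.edge_edge h hx (by decide) (by decide) (by decide) (by decide) (by decide)
      (by decide) hs hw
    set v : Fin 8 → L := ![q - s, β 0, -q, β 1, -p, β 2, -w, β 3] with hv
    have hvmem : ∀ i, v i ∈ Submodule.span ℤ (Set.range v) :=
      fun i => Submodule.subset_span ⟨i, rfl⟩
    refine ⟨v, fun i j => ?_, le_antisymm ?_ ?_, hxx⟩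
    · fin_cases i <;> fin_cases j <;>
      simp [hv, dGram, hβ.apply,
        h.symm (β _) q, h.symm (β _) s, h.symm (β _) p, h.symm (β _) w, hqβ, hsβ, hpβ, hwβ,
        hq.1.1.2, hs.1.1.2, hp.1.1.2, hw.1.1.2, hqp, h.symm p q, hwp, h.symm p w, hsp, h.symm p s,
        hsq, h.symm q s, hqw, h.symm w q, hsw, h.symm w s]
    · rw [Submodule.span_le, Set.range_subset_iff]
      intro i
      fin_cases i
      exacts [R.sub_mem hq.1.1.1 hs.1.1.1, hβR 0, R.neg_mem hq.1.1.1, hβR 1, R.neg_mem hp.1.1.1,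
        hβR 2, R.neg_mem hw.1.1.1, hβR 3]
    · have hqN := neg_mem_iff.1 (hvmem 2)
      have hsN : s ∈ Submodule.span ℤ (Set.range v) := by
        have := sub_mem hqN (hvmem 0)
        rwa [show v 0 = q - s from rfl, sub_sub_cancel] at this
      have hβN : ∀ i, β i ∈ Submodule.span ℤ (Set.range v) := by
        intro i
        fin_cases i
        exacts [hvmem 1, hvmem 3, hvmem 5, hvmem 7]
      refine hβ.le_of_edges_mem h hx hq hp hw hβN hqN (neg_mem_iff.1 (hvmem 4))
        (neg_mem_iff.1 (hvmem 6)) fun t ht => ?_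
      obtain rfl | rfl | htq := hβ.edge_trichotomy h hx hq ht
      · exact hqN
      · exact sub_mem (add_mem (hβN 0) (hβN 1)) hqN
      obtain rfl | rfl | hts := hβ.edge_trichotomy h hx hs ht
      · exact hsN
      · exact sub_mem (add_mem (hβN 0) (hβN 1)) hsN
      exfalso
      obtain htp | htp := hβ.orth_or_flip h hx (by decide) (by decide) (by decide) ht hp
      · exact hβ.no_third_edge h hx hq hp hw hs ht hqp hwp hsp htp hsq htq hts
      · refine hβ.no_third_edge h hx hq hp hw hs (hβ.flip h (by decide) ht) hqp hwp hsp htp hsq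
          ?_ ?_
        · simp [htq, h.symm (β _) q, hqβ]
        · simp [hts, h.symm (β _) s, hsβ]
  · left
    set v : Fin 7 → L := ![β 0, -q, β 1, -p, β 2, -w, β 3] with hv
    have hvmem : ∀ i, v i ∈ Submodule.span ℤ (Set.range v) :=
      fun i => Submodule.subset_span ⟨i, rfl⟩
    refine ⟨v, fun i j => ?_, le_antisymm ?_ ?_, hxx⟩
    · fin_cases i <;> fin_cases j <;>
      simp [hv, aGram, hβ.apply,
        h.symm (β _) q, h.symm (β _) p, h.symm (β _) w, hqβ, hpβ, hwβ,
        hq.1.1.2, hp.1.1.2, hw.1.1.2, hqp, h.symm p q, hwp, h.symm p w, hqw, h.symm w q]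
    · rw [Submodule.span_le, Set.range_subset_iff]
      intro i
      fin_cases i
      exacts [hβR 0, R.neg_mem hq.1.1.1, hβR 1, R.neg_mem hp.1.1.1, hβR 2, R.neg_mem hw.1.1.1,
        hβR 3]
    · have hqN := neg_mem_iff.1 (hvmem 1)
      have hβN : ∀ i, β i ∈ Submodule.span ℤ (Set.range v) := by
        intro i
        fin_cases i
        exacts [hvmem 0, hvmem 2, hvmem 4, hvmem 6]
      refine hβ.le_of_edges_mem h hx hq hp hw hβN hqN (neg_mem_iff.1 (hvmem 3))
        (neg_mem_iff.1 (hvmem 5)) fun t ht => ?_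
      obtain rfl | rfl | htq := hβ.edge_trichotomy h hx hq ht
      · exact hqN
      · exact sub_mem (add_mem (hβN 0) (hβN 1)) hqN
      exfalso
      obtain htp | htp := hβ.orth_or_flip h hx (by decide) (by decide) (by decide) ht hp
      · exact hs ⟨t, ht, htq, htp⟩
      · exact hs ⟨_, hβ.flip h (by decide) ht, by simp [htq, h.symm (β _) q, hqβ], htp⟩

end Classification

theorem exists_basis_of_isMinusculeHalf (h : IsFullRootLattice b R) (hx : IsMinusculeHalf b R x)
    (heven : Even (b x x))
    (hrank : ∀ (n : ℕ) (v : Fin n → L), (∀ i, v i ∈ R) → LinearIndependent ℤ v → n ≤ 12) :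
    (∃ v : Fin 7 → L, (∀ i j, b (v i) (v j) = -aGram 7 i j) ∧
      Submodule.span ℤ (Set.range v) = R ∧ x + x = v 0 + v 2 + v 4 + v 6) ∨
    (∃ v : Fin 8 → L, (∀ i j, b (v i) (v j) = -dGram 8 i j) ∧
      Submodule.span ℤ (Set.range v) = R ∧ x + x = v 1 + v 3 + v 5 + v 7) := by
  obtain ⟨k, β, hβ⟩ := exists_isFrame h hx hrank
  obtain rfl := hβ.size_eq_four h hx heven hrank
  obtain ⟨p, hp⟩ := hβ.exists_edge h hx (i := 1) (j := 2) (by decide)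
  obtain ⟨q, hq, hqp⟩ := hβ.exists_edge_orth h hx (by decide) (by decide) (by decide)
    (hβ.exists_edge h hx (i := 0) (j := 1) (by decide)) hp
  obtain ⟨w, hw, hwp⟩ := hβ.exists_edge_orth h hx (by decide) (by decide) (by decide)
    (hβ.exists_edge h hx (i := 3) (j := 2) (by decide)) hp.symm
  exact hβ.classification h hx hq hp hw.symm hqp hwp

theorem IsFullRootLattice.eq_zero_of_orth (h : IsFullRootLattice b R) {n : ℕ} {v : Fin n → L}
    (hspan : Submodule.span ℤ (Set.range v) = R) {z : L} (hz : ∀ i, b z (v i) = 0) : z = 0 := by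
  obtain ⟨m, hm, hmz⟩ := h.torsion z
  have h1 : R ≤ LinearMap.ker (b z) := by
    rw [← hspan, Submodule.span_le, Set.range_subset_iff]
    exact hz
  have h2 : b z (m • z) = 0 := h1 hmz
  rw [map_smul, smul_eq_mul] at h2
  exact h.eq_zero_of_self ((mul_eq_zero.1 h2).resolve_left hm)

theorem exists_reduction_of_a {v : Fin 7 → L}
    (hv : ∀ i j, b (v i) (v j) = -aGram 7 i j) (y : L) :
    ∃ c ∈ Submodule.span ℤ (Set.range v), ∀ i : Fin 7, i ≠ 6 → b (y + c) (v i) = 0 := by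
  have hvR : ∀ i, v i ∈ Submodule.span ℤ (Set.range v) := fun i => Submodule.subset_span ⟨i, rfl⟩
  obtain ⟨c₁, h₁⟩ : ∃ c, c = b y (v 0) := ⟨_, rfl⟩
  obtain ⟨c₂, h₂⟩ : ∃ c, c = b y (v 1) + 2 * c₁ := ⟨_, rfl⟩
  obtain ⟨c₃, h₃⟩ : ∃ c, c = b y (v 2) - c₁ + 2 * c₂ := ⟨_, rfl⟩
  obtain ⟨c₄, h₄⟩ : ∃ c, c = b y (v 3) - c₂ + 2 * c₃ := ⟨_, rfl⟩
  obtain ⟨c₅, h₅⟩ : ∃ c, c = b y (v 4) - c₃ + 2 * c₄ := ⟨_, rfl⟩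
  obtain ⟨c₆, h₆⟩ : ∃ c, c = b y (v 5) - c₄ + 2 * c₅ := ⟨_, rfl⟩
  refine ⟨c₁ • v 1 + c₂ • v 2 + c₃ • v 3 + c₄ • v 4 + c₅ • v 5 + c₆ • v 6, ?_,
    fun i hi => ?_⟩
  · repeat' apply add_mem
    all_goals exact Submodule.smul_mem _ _ (hvR _)
  · fin_cases i <;> first | exact absurd rfl hi | skip
    all_goals simp [hv, aGram]; omega

theorem pairing_half_of_a {v : Fin 7 → L} (hv : ∀ i j, b (v i) (v j) = -aGram 7 i j)
    (hxx : x + x = v 0 + v 2 + v 4 + v 6) (i : Fin 7) :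
    b x (v i) = ![1, -1, 1, -1, 1, -1, 1] i := by
  have h1 : 2 * b x (v i) = b (v 0 + v 2 + v 4 + v 6) (v i) := by
    rw [← hxx, map_add, LinearMap.add_apply, two_mul]
  fin_cases i <;> simp [hv, aGram] at h1 ⊢ <;> omega

theorem exists_sub_smul_mem_of_a (h : IsFullRootLattice b R) (heven : ∀ u, Even (b u u))
    {v : Fin 7 → L} (hv : ∀ i j, b (v i) (v j) = -aGram 7 i j)
    (hspan : Submodule.span ℤ (Set.range v) = R) (hxx : x + x = v 0 + v 2 + v 4 + v 6) (y : L) :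
    ∃ m : ℤ, y - m • x ∈ R := by
  have hvR : ∀ i, v i ∈ R := fun i => hspan ▸ Submodule.subset_span ⟨i, rfl⟩
  obtain ⟨c, hc, hy⟩ := exists_reduction_of_a hv y
  rw [hspan] at hc
  set z := y + c with hzdef
  obtain ⟨m, hm⟩ : ∃ m, b z (v 6) = m := ⟨_, rfl⟩
  have hz : ∀ i, b z (v i) = ![0, 0, 0, 0, 0, 0, m] i := by
    intro i
    fin_cases i
    exacts [hy _ (by decide), hy _ (by decide), hy _ (by decide), hy _ (by decide),
      hy _ (by decide), hy _ (by decide), hm]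
  clear_value z
  clear hy
  have h8 : (8 : ℤ) • z = m • (v 0 + (2 : ℤ) • v 1 + (3 : ℤ) • v 2 + (4 : ℤ) • v 3 +
      (5 : ℤ) • v 4 + (6 : ℤ) • v 5 + (7 : ℤ) • v 6) := by
    refine sub_eq_zero.1 (h.eq_zero_of_orth hspan fun i => ?_)
    simp only [map_sub, map_add, map_smul, LinearMap.sub_apply, LinearMap.add_apply,
      LinearMap.smul_apply, hz, hv, smul_eq_mul]
    fin_cases i <;> simp [aGram]
    ring
  obtain ⟨e, he⟩ := heven z
  have h16 : 16 * e = 7 * (m * m) := by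
    have := congrArg (b z) h8
    simp only [map_add, map_smul, smul_eq_mul, hz, he] at this
    simp at this
    linarith
  obtain ⟨n, rfl⟩ : ∃ n, m = 4 * n := by
    have h2 : (4 : ℤ) ^ 2 ∣ m ^ 2 := by
      rw [sq m]
      generalize m * m = t at h16 ⊢
      norm_num
      omega
    exact (Int.pow_dvd_pow_iff (by norm_num)).1 h2
  refine ⟨n, ?_⟩
  have h1 : z - n • x = n • (v 1 + v 2 + (2 : ℤ) • v 3 + (2 : ℤ) • v 4 + (3 : ℤ) • v 5 +
      (3 : ℤ) • v 6) := by
    refine sub_eq_zero.1 (h.eq_zero_of_orth hspan fun i => ?_)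
    simp only [map_sub, map_add, map_smul, LinearMap.sub_apply, LinearMap.add_apply,
      LinearMap.smul_apply, hz, hv, smul_eq_mul, pairing_half_of_a hv hxx]
    fin_cases i <;> simp [aGram]
    ring
  have h2 : y - n • x = (z - n • x) - c := by rw [hzdef]; abel
  rw [h2, h1]
  refine R.sub_mem (R.smul_mem _ ?_) hc
  repeat' apply R.add_mem
  all_goals first | exact hvR _ | exact R.smul_mem _ (hvR _)

theorem exists_reduction_of_d {v : Fin 8 → L}
    (hv : ∀ i j, b (v i) (v j) = -dGram 8 i j) (y : L) :
    ∃ c ∈ Submodule.span ℤ (Set.range v), ∀ i : Fin 8, i ≠ 0 → i ≠ 7 → b (y + c) (v i) = 0 := by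
  have hvR : ∀ i, v i ∈ Submodule.span ℤ (Set.range v) := fun i => Submodule.subset_span ⟨i, rfl⟩
  obtain ⟨c₂, h₂⟩ : ∃ c, c = b y (v 1) := ⟨_, rfl⟩
  obtain ⟨c₃, h₃⟩ : ∃ c, c = b y (v 2) + 2 * c₂ := ⟨_, rfl⟩
  obtain ⟨c₄, h₄⟩ : ∃ c, c = b y (v 3) - c₂ + 2 * c₃ := ⟨_, rfl⟩
  obtain ⟨c₅, h₅⟩ : ∃ c, c = b y (v 4) - c₃ + 2 * c₄ := ⟨_, rfl⟩
  obtain ⟨c₆, h₆⟩ : ∃ c, c = b y (v 5) - c₄ + 2 * c₅ := ⟨_, rfl⟩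
  obtain ⟨c₇, h₇⟩ : ∃ c, c = b y (v 6) - c₅ + 2 * c₆ := ⟨_, rfl⟩
  refine ⟨c₂ • v 2 + c₃ • v 3 + c₄ • v 4 + c₅ • v 5 + c₆ • v 6 + c₇ • v 7, ?_,
    fun i hi hi' => ?_⟩
  · repeat' apply add_mem
    all_goals exact Submodule.smul_mem _ _ (hvR _)
  · fin_cases i <;> first | exact absurd rfl hi | exact absurd rfl hi' | skip
    all_goals simp [hv, dGram]; omega

theorem pairing_half_of_d {v : Fin 8 → L} (hv : ∀ i j, b (v i) (v j) = -dGram 8 i j)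
    (hxx : x + x = v 1 + v 3 + v 5 + v 7) (i : Fin 8) :
    b x (v i) = ![0, 1, -1, 1, -1, 1, -1, 1] i := by
  have h1 : 2 * b x (v i) = b (v 1 + v 3 + v 5 + v 7) (v i) := by
    rw [← hxx, map_add, LinearMap.add_apply, two_mul]
  fin_cases i <;> simp [hv, dGram] at h1 ⊢ <;> omega

theorem exists_sub_smul_mem_of_d (h : IsFullRootLattice b R)
    {v : Fin 8 → L} (hv : ∀ i j, b (v i) (v j) = -dGram 8 i j)
    (hspan : Submodule.span ℤ (Set.range v) = R) (hxx : x + x = v 1 + v 3 + v 5 + v 7) (y : L) :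
    ∃ m : ℤ, y - m • x ∈ R := by
  have hvR : ∀ i, v i ∈ R := fun i => hspan ▸ Submodule.subset_span ⟨i, rfl⟩
  obtain ⟨c, hc, hy⟩ := exists_reduction_of_d hv y
  rw [hspan] at hc
  set z := y + c with hzdef
  obtain ⟨m, hm⟩ : ∃ m, b z (v 0) = m := ⟨_, rfl⟩
  obtain ⟨n, hn⟩ : ∃ n, b z x = n := ⟨_, rfl⟩
  have h7 : b z (v 7) = 2 * n := by
    have := congrArg (b z) hxx
    simp only [map_add, hn, hy 1 (by decide) (by decide), hy 3 (by decide) (by decide),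
      hy 5 (by decide) (by decide)] at this
    linarith
  have hz : ∀ i, b z (v i) = ![m, 0, 0, 0, 0, 0, 0, 2 * n] i := by
    intro i
    fin_cases i
    exacts [hm, hy _ (by decide) (by decide), hy _ (by decide) (by decide),
      hy _ (by decide) (by decide), hy _ (by decide) (by decide), hy _ (by decide) (by decide),
      hy _ (by decide) (by decide), h7]
  clear_value z
  refine ⟨m, ?_⟩
  have h1 : z - m • x = m • ((2 : ℤ) • v 0 + v 1 + (3 : ℤ) • v 2 + (2 : ℤ) • v 3 +
      (2 : ℤ) • v 4 + v 5 + v 6) + n • (v 0 + v 1 + (2 : ℤ) • v 2 + (2 : ℤ) • v 3 +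
      (2 : ℤ) • v 4 + (2 : ℤ) • v 5 + (2 : ℤ) • v 6 + (2 : ℤ) • v 7) := by
    refine sub_eq_zero.1 (h.eq_zero_of_orth hspan fun i => ?_)
    simp only [map_sub, map_add, map_smul, LinearMap.sub_apply, LinearMap.add_apply,
      LinearMap.smul_apply, hz, hv, smul_eq_mul, pairing_half_of_d hv hxx]
    fin_cases i <;> simp [dGram]
    ring
  have h2 : y - m • x = (z - m • x) - c := by rw [hzdef]; abel
  rw [h2, h1]
  refine R.sub_mem (R.add_mem (R.smul_mem _ ?_) (R.smul_mem _ ?_)) hc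
  all_goals repeat' apply R.add_mem
  all_goals first | exact hvR _ | exact R.smul_mem _ (hvR _)

theorem mem_or_sub_mem_of_sub_smul_mem (hxx : x + x ∈ R) {y : L} (hy : ∃ m : ℤ, y - m • x ∈ R) :
    y ∈ R ∨ y - x ∈ R := by
  obtain ⟨m, hm⟩ := hy
  obtain ⟨k, rfl | rfl⟩ := m.even_or_odd'
  · left
    have h1 : y = (y - (2 * k) • x) + k • (x + x) := by module
    exact h1 ▸ R.add_mem hm (R.smul_mem _ hxx)
  · right
    have h1 : y - x = (y - (2 * k + 1) • x) + k • (x + x) := by module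
    exact h1 ▸ R.add_mem hm (R.smul_mem _ hxx)

theorem card_quotient_le_two (hx : ∀ y, y ∈ R ∨ y - x ∈ R) : Nat.card (L ⧸ R) ≤ 2 := by
  have h1 : Function.Surjective (![0, R.mkQ x] : Fin 2 → L ⧸ R) := by
    intro q
    obtain ⟨y, rfl⟩ := R.mkQ_surjective q
    rcases hx y with h | h
    · exact ⟨0, ((Submodule.Quotient.mk_eq_zero R).2 h).symm⟩
    · exact ⟨1, ((Submodule.Quotient.eq R).2 h).symm⟩
  simpa using Nat.card_le_card_of_surjective _ h1

theorem exists_notMem_of_two_dvd_card (hfin : Nat.card (L ⧸ R) ≠ 0)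
    (h2 : 2 ∣ Nat.card (L ⧸ R)) : ∃ x, x ∉ R ∧ x + x ∈ R := by
  have : Finite (L ⧸ R) := Nat.finite_of_card_ne_zero hfin
  obtain ⟨q, hq⟩ := exists_prime_addOrderOf_dvd_card' (G := L ⧸ R) 2 h2
  obtain ⟨x, rfl⟩ := R.mkQ_surjective q
  refine ⟨x, fun hx => ?_, ?_⟩
  · rw [R.mkQ_apply, (Submodule.Quotient.mk_eq_zero R).2 hx, addOrderOf_zero] at hq
    omega
  · have h := addOrderOf_nsmul_eq_zero (R.mkQ x)
    rw [hq, two_nsmul, ← map_add] at h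
    exact (Submodule.Quotient.mk_eq_zero R).1 h

theorem IsFullRootLattice.exists_isMinusculeHalf (h : IsFullRootLattice b R)
    (hx : ∃ x, x ∉ R ∧ x + x ∈ R) : ∃ x, IsMinusculeHalf b R x := by
  obtain ⟨x, ⟨hxR, hxx⟩, hmin⟩ := exists_minimalFor_of_wellFoundedLT
    (fun x => x ∉ R ∧ x + x ∈ R) (fun x => (b x x).toNat) hx
  refine ⟨x, fun r hr => ?_, hxx, hxR⟩
  by_contra! hlt
  have h1 : x - r ∉ R := fun hm => hxR (by simpa using R.add_mem hm hr.1)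
  have h2 : (x - r) + (x - r) ∈ R := by
    rw [show (x - r) + (x - r) = (x + x) - (r + r) by abel]
    exact R.sub_mem hxx (R.add_mem hr.1 hr.1)
  have h3 : b (x - r) (x - r) = b x x - 2 * b x r + 2 := by
    simp only [map_sub, LinearMap.sub_apply, h.symm r x, hr.2]
    ring
  have h4 : 0 < b x x := h.pos x (fun h0 => hxR (h0 ▸ R.zero_mem))
  have h5 : (b (x - r) (x - r)).toNat < (b x x).toNat := by omega
  exact absurd (hmin ⟨h1, h2⟩ h5.le) (not_le.2 h5)

theorem IsFullRootLattice.exists_basis_of_two_dvd_card (h : IsFullRootLattice b R)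
    (heven : ∀ u, Even (b u u))
    (hrank : ∀ (n : ℕ) (v : Fin n → L), (∀ i, v i ∈ R) → LinearIndependent ℤ v → n ≤ 12)
    (hfin : Nat.card (L ⧸ R) ≠ 0) (h2 : 2 ∣ Nat.card (L ⧸ R)) :
    Nat.card (L ⧸ R) ≤ 2 ∧
      ((∃ v : Fin 7 → L, (∀ i j, b (v i) (v j) = -aGram 7 i j) ∧
          Submodule.span ℤ (Set.range v) = R) ∨
        ∃ v : Fin 8 → L, (∀ i j, b (v i) (v j) = -dGram 8 i j) ∧
          Submodule.span ℤ (Set.range v) = R) := by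
  obtain ⟨x, hx⟩ := h.exists_isMinusculeHalf (exists_notMem_of_two_dvd_card hfin h2)
  rcases exists_basis_of_isMinusculeHalf h hx (heven x) hrank with
    ⟨v, hv, hspan, hxx⟩ | ⟨v, hv, hspan, hxx⟩
  · exact ⟨card_quotient_le_two fun y => mem_or_sub_mem_of_sub_smul_mem hx.double_mem
      (exists_sub_smul_mem_of_a h heven hv hspan hxx y), Or.inl ⟨v, hv, hspan⟩⟩
  · exact ⟨card_quotient_le_two fun y => mem_or_sub_mem_of_sub_smul_mem hx.double_mem
      (exists_sub_smul_mem_of_d h hv hspan hxx y), Or.inr ⟨v, hv, hspan⟩⟩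

end RootLattice

theorem Submodule.mem_span_preimage_subtype {M : Type*} [AddCommGroup M]
    {R' : Submodule ℤ M} {A : Set M} {u : R'} (hA : A ⊆ R')
    (hu : (u : M) ∈ Submodule.span ℤ A) :
    u ∈ Submodule.span ℤ (R'.subtype ⁻¹' A) := by
  have h1 : (Submodule.span ℤ (R'.subtype ⁻¹' A)).map R'.subtype = Submodule.span ℤ A := by
    rw [Submodule.map_span, Set.image_preimage_eq_of_subset]
    simpa using hA
  rw [← h1] at hu
  obtain ⟨w, hw, hwu⟩ := hu
  rwa [← Subtype.ext hwu]

section RationalSpace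

variable {V : Type*} [AddCommGroup V] [Module ℚ V] {B : V →ₗ[ℚ] V →ₗ[ℚ] ℚ}

theorem exists_neg_integral_form {R : Submodule ℤ V}
    (hint : ∀ x ∈ R, ∀ y ∈ R, ∃ n : ℤ, B x y = n) :
    ∃ b : R →ₗ[ℤ] R →ₗ[ℤ] ℤ, ∀ u v : R, (b u v : ℚ) = -B u v := by
  have hint' : ∀ u v : R, ∃ n : ℤ, B u v = n := fun u v => hint u u.2 v v.2
  choose f hf using hint'
  refine ⟨LinearMap.mk₂ ℤ (fun u v => -f u v) ?_ ?_ ?_ ?_, fun u v => ?_⟩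
  · intro u u' v
    have : ((-f (u + u') v : ℤ) : ℚ) = ((-f u v + -f u' v : ℤ) : ℚ) := by
      push_cast
      simp only [← hf, Submodule.coe_add, map_add, LinearMap.add_apply, neg_add]
    exact_mod_cast this
  · intro c u v
    have : ((-f (c • u) v : ℤ) : ℚ) = ((c * -f u v : ℤ) : ℚ) := by
      push_cast
      rw [← hf, ← hf, Submodule.coe_smul, ← Int.cast_smul_eq_zsmul ℚ c (u : V)]
      simp
    exact_mod_cast this
  · intro u v v'
    have : ((-f u (v + v') : ℤ) : ℚ) = ((-f u v + -f u v' : ℤ) : ℚ) := by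
      push_cast
      simp only [← hf, Submodule.coe_add, map_add, neg_add]
    exact_mod_cast this
  · intro c u v
    have : ((-f u (c • v) : ℤ) : ℚ) = ((c * -f u v : ℤ) : ℚ) := by
      push_cast
      rw [← hf, ← hf, Submodule.coe_smul, ← Int.cast_smul_eq_zsmul ℚ c (v : V)]
      simp
    exact_mod_cast this
  · rw [LinearMap.mk₂_apply, hf]
    push_cast
    rfl

theorem LinearIndependent.card_le_finrank_int [FiniteDimensional ℚ V] {R : Submodule ℤ V} {n : ℕ}
    {v : Fin n → V} (hv : ∀ i, v i ∈ R) (hli : LinearIndependent ℤ v) :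
    n ≤ Module.finrank ℤ R := by
  have hfin : Module.rank ℤ R < Cardinal.aleph0 := by
    refine (Submodule.rank_le R).trans_lt ?_
    rw [← IsLocalization.rank_eq (R := ℤ) ℚ (nonZeroDivisors ℤ) le_rfl]
    exact Module.rank_lt_aleph0 ℚ V
  have hw : LinearIndependent ℤ (fun i => (⟨v i, hv i⟩ : R)) :=
    LinearIndependent.of_comp R.subtype hli
  have h1 := hw.cardinal_lift_le_rank
  rw [← Nat.cast_le (α := Cardinal), Module.finrank, Cardinal.cast_toNat_of_lt_aleph0 hfin]
  simpa using h1

theorem isoToGramQ_of_gram {R : Submodule ℤ V} {n : ℕ} {G : Matrix (Fin n) (Fin n) ℤ}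
    (hG : ∀ g : Fin n → ℤ, G.mulVec g = 0 → g = 0) {v : Fin n → V}
    (hv : ∀ i j, B (v i) (v j) = G i j) (hspan : Submodule.span ℤ (Set.range v) = R) :
    IsoToGramQ B R n G := by
  have hB : ∀ x y : Fin n → ℤ, B (Fintype.linearCombination ℤ v x)
      (Fintype.linearCombination ℤ v y) = ((x ⬝ᵥ G.mulVec y : ℤ) : ℚ) := by
    intro x y
    simp only [Fintype.linearCombination_apply, ← Int.cast_smul_eq_zsmul ℚ, map_sum, map_smul,
      LinearMap.sum_apply, LinearMap.smul_apply, hv, dotProduct, Matrix.mulVec, smul_eq_mul,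
      Finset.mul_sum]
    push_cast
    rw [Finset.sum_comm]
    exact Finset.sum_congr rfl fun i _ => Finset.sum_congr rfl fun j _ => by ring
  refine ⟨Fintype.linearCombination ℤ v, ?_, ?_, hB⟩
  · refine (injective_iff_map_eq_zero _).2 fun g hg => hG g (funext fun i => ?_)
    have h := hB (Pi.single i 1) g
    rw [hg, map_zero] at h
    simpa using h.symm
  · rw [Fintype.range_linearCombination, hspan]

theorem eq_zero_of_aGram_mulVec {g : Fin 7 → ℤ} (h : (aGram 7).mulVec g = 0) : g = 0 := by
  have h1 := congrFun h
  simp only [Fin.forall_fin_succ, Matrix.mulVec, dotProduct, Fin.sum_univ_succ, aGram] at h1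
  simp at h1
  ext i
  fin_cases i <;> simp <;> omega

theorem eq_zero_of_dGram_mulVec {g : Fin 8 → ℤ} (h : (dGram 8).mulVec g = 0) : g = 0 := by
  have h1 := congrFun h
  simp only [Fin.forall_fin_succ, Matrix.mulVec, dotProduct, Fin.sum_univ_succ, dGram] at h1
  simp at h1
  ext i
  fin_cases i <;> simp <;> omega

theorem isFullRootLattice_of_rational {R R' : Submodule ℤ V} (hsymm : ∀ x y : V, B x y = B y x)
    (hRR' : R ≤ R') (hroot : R = Submodule.span ℤ {r : V | r ∈ R ∧ B r r = -2})
    (hnegdef : ∀ x ∈ R, x ≠ 0 → B x x < 0)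
    (hirr : ¬ ∃ S T : Set V, S ∪ T = {r : V | r ∈ R ∧ B r r = -2} ∧
        S.Nonempty ∧ T.Nonempty ∧ S ∩ T = ∅ ∧ ∀ s ∈ S, ∀ t ∈ T, B s t = 0)
    (hfinindex : ∀ x ∈ R', ∃ n : ℤ, n ≠ 0 ∧ n • x ∈ R)
    {b : R' →ₗ[ℤ] R' →ₗ[ℤ] ℤ} (hb : ∀ u v : R', (b u v : ℚ) = -B u v) :
    IsFullRootLattice b (R.comap R'.subtype) := by
  have hbroot : ∀ r : R', IsRootIn b (R.comap R'.subtype) r ↔ (r : V) ∈ R ∧ B r r = -2 := by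
    intro r
    refine and_congr Iff.rfl ?_
    rw [← @Int.cast_inj ℚ, hb]
    constructor <;> intro h <;> push_cast at * <;> linarith
  have hbsymm : ∀ u v, b u v = b v u := fun u v => by
    rw [← @Int.cast_inj ℚ, hb, hb, hsymm]
  have hgen : R.comap R'.subtype ≤
      Submodule.span ℤ {r | IsRootIn b (R.comap R'.subtype) r} := by
    intro u hu
    have h1 : (u : V) ∈ Submodule.span ℤ {r : V | r ∈ R ∧ B r r = -2} := hroot ▸ hu
    have h2 := Submodule.mem_span_preimage_subtype (fun r hr => hRR' hr.1) h1
    refine Submodule.span_mono (fun r hr => ?_) h2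
    exact (hbroot r).2 hr
  refine ⟨hbsymm, fun u hu => ?_, hgen, fun A hA hAroot hAorth => ?_, fun u => ?_⟩
  · obtain ⟨n, hn, hnu⟩ := hfinindex u u.2
    rw [← Int.cast_smul_eq_zsmul ℚ] at hnu
    have hn' : (n : ℚ) ≠ 0 := by exact_mod_cast hn
    have h1 := hnegdef _ hnu (smul_ne_zero hn' (by simpa using hu))
    simp only [map_smul, LinearMap.smul_apply, smul_eq_mul] at h1
    have h2 : (0 : ℚ) < b u u := by
      rw [hb]
      nlinarith [mul_self_pos.2 hn']
    exact_mod_cast h2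
  · refine hgen.trans (Submodule.span_le.2 fun r hr => ?_)
    by_contra hrA
    refine hirr ⟨{s | (s ∈ R ∧ B s s = -2) ∧ ∃ u : R', u ∈ Submodule.span ℤ A ∧ (u : V) = s},
      {s | (s ∈ R ∧ B s s = -2) ∧ ¬ ∃ u : R', u ∈ Submodule.span ℤ A ∧ (u : V) = s},
      ?_, ?_, ?_, ?_, ?_⟩
    · ext s
      exact and_or_left.symm.trans (and_iff_left (em _))
    · obtain ⟨a, ha⟩ := hA
      exact ⟨a, (hbroot a).1 (hAroot a ha), a, Submodule.subset_span ha, rfl⟩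
    · refine ⟨r, (hbroot r).1 hr, ?_⟩
      rintro ⟨u, hu, hur⟩
      exact hrA (Subtype.ext hur ▸ hu)
    · exact Set.eq_empty_of_forall_notMem fun s hs => hs.2.2 hs.1.2
    · rintro _ ⟨-, u, hu, rfl⟩ t ⟨ht, htA⟩
      obtain ⟨t, rfl⟩ : ∃ t' : R', (t' : V) = t := ⟨⟨t, hRR' ht.1⟩, rfl⟩
      have h1 : ∀ a ∈ A, b t a = 0 :=
        (hAorth t ((hbroot t).2 ht)).resolve_left fun h => htA ⟨t, h, rfl⟩
      have h2 : Submodule.span ℤ A ≤ LinearMap.ker (b t) := Submodule.span_le.2 h1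
      have h3 : b t u = 0 := h2 hu
      rw [hbsymm, ← @Int.cast_inj ℚ, hb] at h3
      simpa using h3
  · obtain ⟨n, hn, hnu⟩ := hfinindex u u.2
    exact ⟨n, hn, hnu⟩

theorem isoToGramQ_of_basis {R R' : Submodule ℤ V} (hRR' : R ≤ R')
    {b : R' →ₗ[ℤ] R' →ₗ[ℤ] ℤ} (hb : ∀ u v : R', (b u v : ℚ) = -B u v) {n : ℕ}
    {G : Matrix (Fin n) (Fin n) ℤ} (hG : ∀ g : Fin n → ℤ, G.mulVec g = 0 → g = 0)
    (h : ∃ v : Fin n → R', (∀ i j, b (v i) (v j) = -G i j) ∧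
      Submodule.span ℤ (Set.range v) = R.comap R'.subtype) : IsoToGramQ B R n G := by
  obtain ⟨v, hv, hspan⟩ := h
  refine isoToGramQ_of_gram hG (v := fun i => (v i : V)) (fun i j => ?_) ?_
  · have h1 := hb (v i) (v j)
    rw [hv] at h1
    push_cast at h1
    linarith
  · have h1 := congrArg (Submodule.map R'.subtype) hspan
    rw [Submodule.map_span, Submodule.map_comap_subtype, inf_eq_right.2 hRR',
      ← Set.range_comp] at h1
    exact h1

end RationalSpace

/-- Let `R` be an irreducible negative definite root lattice of rank at
most `12` and `R ⊆ R' ⊆ R ⊗ ℚ` an even overlattice of finite index. Then the 2-adic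
valuation of `[R' : R]` is at most `1`, and if it equals `1` then `R ≅ A₇` or
`R ≅ D₈`. -/
theorem even_overlattice_two_valuation (V : Type*) [AddCommGroup V] [Module ℚ V]
    [FiniteDimensional ℚ V]
    (B : V →ₗ[ℚ] V →ₗ[ℚ] ℚ) (hsymm : ∀ x y : V, B x y = B y x)
    (R R' : Submodule ℤ V) (hRR' : R ≤ R')
    (hint : ∀ x ∈ R, ∀ y ∈ R, ∃ n : ℤ, B x y = n)
    (hroot : R = Submodule.span ℤ {r : V | r ∈ R ∧ B r r = -2})
    (hnegdef : ∀ x ∈ R, x ≠ 0 → B x x < 0)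
    (hirr : ¬ ∃ S T : Set V, S ∪ T = {r : V | r ∈ R ∧ B r r = -2} ∧
        S.Nonempty ∧ T.Nonempty ∧ S ∩ T = ∅ ∧ ∀ s ∈ S, ∀ t ∈ T, B s t = 0)
    (hrank : Module.finrank ℤ ↥R ≤ 12)
    (hint' : ∀ x ∈ R', ∀ y ∈ R', ∃ n : ℤ, B x y = n)
    (heven : ∀ x ∈ R', ∃ n : ℤ, B x x = 2 * n)
    (hfinindex : ∀ x ∈ R', ∃ n : ℤ, n ≠ 0 ∧ n • x ∈ R) :
    (Nat.card (↥R' ⧸ Submodule.comap R'.subtype R)).factorization 2 ≤ 1 ∧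
    ((Nat.card (↥R' ⧸ Submodule.comap R'.subtype R)).factorization 2 = 1 →
      IsoToGramQ B R 7 (aGram 7) ∨ IsoToGramQ B R 8 (dGram 8)) := by
  set N := Nat.card (↥R' ⧸ Submodule.comap R'.subtype R)
  by_cases h0 : N.factorization 2 = 0
  · exact ⟨by omega, fun h => by omega⟩
  have hN0 : N ≠ 0 := fun h => h0 (by simp [h])
  have hN2 : 2 ∣ N := Nat.dvd_of_factorization_pos h0
  obtain ⟨b, hb⟩ := exists_neg_integral_form hint'
  have h := isFullRootLattice_of_rational hsymm hRR' hroot hnegdef hirr hfinindex hb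
  have hbeven : ∀ u, Even (b u u) := by
    intro u
    obtain ⟨n, hn⟩ := heven u u.2
    refine ⟨-n, ?_⟩
    rw [← @Int.cast_inj ℚ, hb, hn]
    push_cast
    ring
  obtain ⟨hle, hbasis⟩ := h.exists_basis_of_two_dvd_card hbeven
    (fun n v hv hli => (LinearIndependent.card_le_finrank_int (v := fun i => (v i : V)) hv
      (hli.map' R'.subtype R'.ker_subtype)).trans hrank) hN0 hN2
  refine ⟨?_, fun _ => hbasis.imp (isoToGramQ_of_basis hRR' hb fun _ => eq_zero_of_aGram_mulVec)
    (isoToGramQ_of_basis hRR' hb fun _ => eq_zero_of_dGram_mulVec)⟩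
  have hN' : N = 2 := Nat.le_antisymm hle (Nat.le_of_dvd (Nat.pos_of_ne_zero hN0) hN2)
  rw [hN', Nat.prime_two.factorization_self]
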